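/- Let α be irrational with 0 < α < 1. Then for all integers i, j with 0 ≤ i < j, q_i D_j = (α_{i+1}α_{i+2}⋯α_j)/(1 − ᾱ_i α_{i+1}). -/

import Mathlib

open Filter Finset

/-- Distance from `x` to the nearest integer. -/
noncomputable def nint (x : ℝ) : ℝ := |x - (round x : ℝ)|

/-- One-sided inhomogeneous approximation constant
`M₊(α,β) = liminf_{q→∞} q‖qα−β‖` over positive integers `q`. -/
noncomputable def Mplus (α β : ℝ) : ℝ :=
  Filter.liminf (fun q : ℕ => (q : ℝ) * nint (q * α - β)) Filter.atTop

/-- Complete quotients of the negative continued fraction: `ncq α i = α_{i+1}`,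
so `ncq α 0 = α₁ = α` and `α_{i+1} = a_i - 1/α_i` with `a_i = ⌈1/α_i⌉`. -/
noncomputable def ncq (α : ℝ) : ℕ → ℝ
  | 0 => α
  | i + 1 => (⌈(ncq α i)⁻¹⌉ : ℝ) - (ncq α i)⁻¹

/-- Partial quotients of the negative continued fraction: `npq α i = a_i = ⌈1/α_i⌉` for `i ≥ 1`. -/
noncomputable def npq (α : ℝ) (i : ℕ) : ℤ := ⌈(ncq α (i - 1))⁻¹⌉

/-- Convergent denominators: `q₀ = 1`, `q₁ = a₁`, `q_{i+2} = a_{i+2} q_{i+1} − q_i`. -/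
noncomputable def nq (α : ℝ) : ℕ → ℤ
  | 0 => 1
  | 1 => npq α 1
  | i + 2 => npq α (i + 2) * nq α (i + 1) - nq α i

/-- Convergent numerators: `p₀ = 0`, `p₁ = 1`, `p_{i+2} = a_{i+2} p_{i+1} − p_i`. -/
noncomputable def np (α : ℝ) : ℕ → ℤ
  | 0 => 0
  | 1 => 1
  | i + 2 => npq α (i + 2) * np α (i + 1) - np α i

/-- `Dk α k = α₁α₂⋯α_k` (with `Dk α 0 = 1`). -/
noncomputable def Dk (α : ℝ) (k : ℕ) : ℝ := ∏ j ∈ Finset.range k, ncq α j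

/-- Davenport remainders: `drem α β i = β_{i+1}`, so `drem α β 0 = β₁ = β` and
`β_{i+1} = β_i/α_i − ⌊β_i/α_i⌋`. -/
noncomputable def drem (α β : ℝ) : ℕ → ℝ
  | 0 => β
  | i + 1 => Int.fract (drem α β i / ncq α i)

/-- Davenport coefficients: `db α β i = b_i = ⌊β_i/α_i⌋` for `i ≥ 1`. -/
noncomputable def db (α β : ℝ) (i : ℕ) : ℤ := ⌊drem α β (i - 1) / ncq α (i - 1)⌋

/-- `Qn α β n = Σ_{k=1}^n b_k q_{k−1}`. -/
noncomputable def Qn (α β : ℝ) (n : ℕ) : ℤ :=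
  ∑ k ∈ Finset.Icc 1 n, db α β k * nq α (k - 1)

/-- `Q′_n`. -/
noncomputable def Qn' (α β : ℝ) (n : ℕ) : ℤ :=
  if Qn α β n < nq α n - nq α (n - 1) then Qn α β n + nq α (n - 1)
  else Qn α β n + nq α (n - 1) - nq α n

/-- `λ_n(β) = Q_n D_n β_{n+1}`. -/
noncomputable def lam (α β : ℝ) (n : ℕ) : ℝ :=
  (Qn α β n : ℝ) * Dk α n * drem α β n

/-- `ρ_n(β)`. -/
noncomputable def rho (α β : ℝ) (n : ℕ) : ℝ :=
  if Qn α β n < nq α n - nq α (n - 1)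
  then (Qn' α β n : ℝ) * Dk α n * (1 - drem α β n)
  else (Qn' α β n : ℝ) * Dk α n * (1 - ncq α n - drem α β n)

/-- Reversed quotients: `ᾱ₀ = 0`, `ᾱ_i = 1/(a_i − ᾱ_{i−1})`. -/
noncomputable def rq (α : ℝ) : ℕ → ℝ
  | 0 => 0
  | i + 1 => ((npq α (i + 1) : ℝ) - rq α i)⁻¹

theorem ncq_irrational_mem_Ioo {α : ℝ} (hirr : Irrational α) (h0 : 0 < α) (h1 : α < 1) (i : ℕ) :
    Irrational (ncq α i) ∧ 0 < ncq α i ∧ ncq α i < 1 := by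
  induction i with
  | zero => exact ⟨hirr, h0, h1⟩
  | succ i ih =>
    have hi : Irrational (ncq α (i + 1)) := ih.1.inv.intCast_sub _
    have hnonneg : 0 ≤ ncq α (i + 1) := sub_nonneg.2 (Int.le_ceil _)
    refine ⟨hi, lt_of_le_of_ne hnonneg hi.ne_zero.symm, ?_⟩
    have := Int.ceil_lt_add_one (ncq α i)⁻¹
    simp only [ncq]
    linarith

theorem two_le_npq_succ {α : ℝ} (hirr : Irrational α) (h0 : 0 < α) (h1 : α < 1) (i : ℕ) :
    2 ≤ npq α (i + 1) := by
  obtain ⟨-, hpos, hlt⟩ := ncq_irrational_mem_Ioo hirr h0 h1 i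
  have h : (1 : ℤ) < ⌈(ncq α i)⁻¹⌉ := by
    rw [Int.lt_ceil]
    exact_mod_cast (one_lt_inv₀ hpos).2 hlt
  exact h

theorem rq_mem_Ico {α : ℝ} (hirr : Irrational α) (h0 : 0 < α) (h1 : α < 1) (i : ℕ) :
    0 ≤ rq α i ∧ rq α i < 1 := by
  induction i with
  | zero => simp [rq]
  | succ i ih =>
    have ha : (2 : ℝ) ≤ npq α (i + 1) := by exact_mod_cast two_le_npq_succ hirr h0 h1 i
    have h : 1 < (npq α (i + 1) : ℝ) - rq α i := by linarith [ih.2]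
    exact ⟨inv_nonneg.2 (by linarith), inv_lt_one_of_one_lt₀ h⟩

theorem nq_succ_eq_mul {α : ℝ} (hirr : Irrational α) (h0 : 0 < α) (h1 : α < 1) (i : ℕ) :
    (nq α (i + 1) : ℝ) = nq α i * (npq α (i + 1) - rq α i) := by
  induction i with
  | zero => simp [nq, rq]
  | succ i ih =>
    have ha : (2 : ℝ) ≤ npq α (i + 1) := by exact_mod_cast two_le_npq_succ hirr h0 h1 i
    have h : (npq α (i + 1) : ℝ) - rq α i ≠ 0 :=
      ne_of_gt (by linarith [(rq_mem_Ico hirr h0 h1 i).2])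
    have hq : (nq α (i + 1) : ℝ) * rq α (i + 1) = nq α i := by
      rw [ih, rq, mul_assoc, mul_inv_cancel₀ h, mul_one]
    rw [mul_sub, hq, nq]
    push_cast
    ring

theorem nq_mul_Dk_mul_one_sub {α : ℝ} (hirr : Irrational α) (h0 : 0 < α) (h1 : α < 1) (i : ℕ) :
    (nq α i : ℝ) * Dk α i * (1 - rq α i * ncq α i) = 1 := by
  induction i with
  | zero => simp [nq, rq, Dk]
  | succ i ih =>
    have hx : ncq α i ≠ 0 := (ncq_irrational_mem_Ioo hirr h0 h1 i).1.ne_zero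
    have ha : (2 : ℝ) ≤ npq α (i + 1) := by exact_mod_cast two_le_npq_succ hirr h0 h1 i
    have h : (npq α (i + 1) : ℝ) - rq α i ≠ 0 :=
      ne_of_gt (by linarith [(rq_mem_Ico hirr h0 h1 i).2])
    have hn : ncq α (i + 1) = npq α (i + 1) - (ncq α i)⁻¹ := rfl
    have hD : Dk α (i + 1) = Dk α i * ncq α i := Finset.prod_range_succ _ _
    refine Eq.trans ?_ ih
    rw [nq_succ_eq_mul hirr h0 h1, hD, hn, rq]
    field_simp
    ring

/-- For all `0 ≤ i < j`,
`q_i D_j = (α_{i+1}α_{i+2}⋯α_j)/(1 − ᾱ_i α_{i+1})`.  Here `α_{i+1}⋯α_j = ∏_{k∈[i,j)} ncq α k`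
and `α_{i+1} = ncq α i`. -/
theorem stmt15 (α : ℝ) (hirr : Irrational α) (h0 : 0 < α) (h1 : α < 1) :
    ∀ i j : ℕ, i < j →
      (nq α i : ℝ) * Dk α j =
        (∏ k ∈ Finset.Ico i j, ncq α k) / (1 - rq α i * ncq α i) := by
  intro i j hij
  have h := nq_mul_Dk_mul_one_sub hirr h0 h1 i
  have hD : Dk α j = Dk α i * ∏ k ∈ Finset.Ico i j, ncq α k :=
    (Finset.prod_range_mul_prod_Ico _ hij.le).symm
  rw [eq_div_iff (right_ne_zero_of_mul_eq_one h), hD]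
  linear_combination (∏ k ∈ Finset.Ico i j, ncq α k) * h
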